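/- arXiv:1503.07691 — 2 statements merged into one kernel-verified Lean document; each statement's English description precedes it below -/
import Mathlib

section
/- Let H_1, H_2, …, H_k be distinct subcubes of the n-dimensional Boolean hypercube Q_n such that the Hamming distance between any two of them is at least 2. Let T = ∪_{i=1}^k H_i (as a vertex set) and T' = { x ∈ {0,1}^n | ∃ i, x^{i} ∈ T } \ T. If T ≠ {0,1}^n, then |T'| ≥ |T|. -/
/-- The input `x` with its `i`-th coordinate flipped. -/
def flipCoord {n : ℕ} (x : Fin n → Bool) (i : Fin n) : Fin n → Bool :=
  Function.update x i (!(x i))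

/-- A subcube of the hypercube `Q_n`: the set of vertices agreeing with a fixed
partial assignment `c` on a set of coordinates `P`. -/
def IsSubcube {n : ℕ} (S : Finset (Fin n → Bool)) : Prop :=
  ∃ (P : Finset (Fin n)) (c : Fin n → Bool),
    S = Finset.univ.filter fun x => ∀ i ∈ P, x i = c i

/-- The vertices outside `S` with a neighbour in `S`. -/
def outerBoundary {n : ℕ} (S : Finset (Fin n → Bool)) : Finset (Fin n → Bool) :=
  Finset.univ.filter fun x => x ∉ S ∧ ∃ i, flipCoord x i ∈ S

/-- A set of vertices containing the fourth vertex of every two-dimensional face of which it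
contains three vertices. -/
def FaceClosed {n : ℕ} (S : Finset (Fin n → Bool)) : Prop :=
  ∀ x i j, i ≠ j → x ∈ S → flipCoord x i ∈ S → flipCoord x j ∈ S →
    flipCoord (flipCoord x i) j ∈ S

/-- The slice of `S` on which the first coordinate is `b`. -/
def firstSlice {n : ℕ} (b : Bool) (S : Finset (Fin (n + 1) → Bool)) : Finset (Fin n → Bool) :=
  Finset.univ.filter fun y => (Fin.cons b y : Fin (n + 1) → Bool) ∈ S

theorem mem_firstSlice {n : ℕ} {b : Bool} {S : Finset (Fin (n + 1) → Bool)} {y : Fin n → Bool} :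
    y ∈ firstSlice b S ↔ (Fin.cons b y : Fin (n + 1) → Bool) ∈ S := by
  simp [firstSlice]

theorem flipCoord_cons_zero {n : ℕ} (b : Bool) (y : Fin n → Bool) :
    flipCoord (Fin.cons b y : Fin (n + 1) → Bool) 0 = Fin.cons (!b) y := by
  simp [flipCoord]

theorem flipCoord_cons_succ {n : ℕ} (b : Bool) (y : Fin n → Bool) (i : Fin n) :
    flipCoord (Fin.cons b y : Fin (n + 1) → Bool) i.succ = Fin.cons b (flipCoord y i) := by
  simp [flipCoord, Fin.cons_update]

theorem card_eq_card_firstSlice_add {n : ℕ} (b : Bool) (S : Finset (Fin (n + 1) → Bool)) :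
    S.card = (firstSlice b S).card + (firstSlice (!b) S).card := by
  have h : ∀ c, (firstSlice c S).card = (S.filter fun x => x 0 = c).card := by
    intro c
    refine Finset.card_bij (fun y _ => Fin.cons c y) ?_ ?_ ?_
    · intro y hy
      simpa [mem_firstSlice] using hy
    · intro y _ z _ hyz
      exact Fin.cons_right_injective (α := fun _ => Bool) c hyz
    · intro x hx
      obtain ⟨hxS, rfl⟩ := Finset.mem_filter.1 hx
      exact ⟨Fin.tail x, by simpa [mem_firstSlice] using hxS, by simp⟩
  rw [h, h, ← Finset.card_filter_add_card_filter_not (s := S) (fun x => x 0 = b)]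
  congr 3
  ext x
  cases x 0 <;> cases b <;> simp

theorem FaceClosed.firstSlice {n : ℕ} {S : Finset (Fin (n + 1) → Bool)} (hS : FaceClosed S)
    (b : Bool) : FaceClosed (firstSlice b S) := by
  intro x i j hij hx hi hj
  simp only [mem_firstSlice, ← flipCoord_cons_succ] at *
  exact hS _ _ _ (by simpa using hij) hx hi hj

theorem outerBoundary_firstSlice_subset {n : ℕ} (b : Bool) (S : Finset (Fin (n + 1) → Bool)) :
    outerBoundary (firstSlice b S) ⊆ firstSlice b (outerBoundary S) := by
  intro y hy
  simp only [outerBoundary, Finset.mem_filter, Finset.mem_univ, true_and, mem_firstSlice,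
    ← flipCoord_cons_succ] at hy ⊢
  exact ⟨hy.1, _, hy.2.choose_spec⟩

theorem eq_univ_of_flipCoord_mem {n : ℕ} {S : Finset (Fin n → Bool)} (hne : S.Nonempty)
    (hS : ∀ x ∈ S, ∀ i, flipCoord x i ∈ S) : S = Finset.univ := by
  obtain ⟨x, hx⟩ := hne
  refine Finset.eq_univ_iff_forall.2 fun y => ?_
  have h : ∀ D : Finset (Fin n), D.piecewise y x ∈ S := by
    intro D
    induction D using Finset.induction_on with
    | empty => simpa using hx
    | insert j D _ ih =>
      rw [Finset.piecewise_insert]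
      by_cases hj : y j = D.piecewise y x j
      · rwa [hj, Function.update_eq_self]
      · rw [Bool.eq_not_of_ne hj]
        exact hS _ ih j
  simpa using h Finset.univ

theorem FaceClosed.firstSlice_not_eq_empty {n : ℕ} {S : Finset (Fin (n + 1) → Bool)}
    (hS : FaceClosed S) (hne : S ≠ Finset.univ) {b : Bool}
    (hb : _root_.firstSlice b S = Finset.univ) : _root_.firstSlice (!b) S = ∅ := by
  have hmem : ∀ y : Fin n → Bool, (Fin.cons b y : Fin (n + 1) → Bool) ∈ S := fun y =>
    mem_firstSlice.1 (hb ▸ Finset.mem_univ y)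
  by_contra hempty
  have huniv := eq_univ_of_flipCoord_mem (Finset.nonempty_iff_ne_empty.2 hempty) (by
    intro y hy i
    rw [mem_firstSlice] at hy ⊢
    rw [← flipCoord_cons_succ, ← flipCoord_cons_zero]
    refine hS _ _ _ (Fin.succ_ne_zero i).symm (hmem y) ?_ ?_
    · rwa [flipCoord_cons_zero]
    · rw [flipCoord_cons_succ]
      exact hmem _)
  refine hne (Finset.eq_univ_of_card _ ?_)
  rw [card_eq_card_firstSlice_add b, hb, huniv]
  simp [pow_succ, mul_two]

theorem FaceClosed.card_le_card_outerBoundary {n : ℕ} {S : Finset (Fin n → Bool)}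
    (hS : FaceClosed S) (hne : S ≠ Finset.univ) : S.card ≤ (outerBoundary S).card := by
  induction n with
  | zero =>
    have hempty : S = ∅ := by
      by_contra h
      exact hne (eq_univ_of_flipCoord_mem (Finset.nonempty_iff_ne_empty.2 h)
        fun _ _ i => i.elim0)
    simp [hempty]
  | succ n ih =>
    by_cases hfull : ∃ b, _root_.firstSlice b S = Finset.univ
    · obtain ⟨b, hb⟩ := hfull
      have hempty := hS.firstSlice_not_eq_empty hne hb
      have hboundary : _root_.firstSlice (!b) (outerBoundary S) = Finset.univ := by
        refine Finset.eq_univ_iff_forall.2 fun y => ?_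
        have hmem : y ∈ _root_.firstSlice b S := hb ▸ Finset.mem_univ y
        have hnot : y ∉ _root_.firstSlice (!b) S := by simp [hempty]
        rw [mem_firstSlice] at hmem hnot ⊢
        exact Finset.mem_filter.2 ⟨Finset.mem_univ _, hnot, 0, by
          rwa [flipCoord_cons_zero, Bool.not_not]⟩
      rw [card_eq_card_firstSlice_add b S, card_eq_card_firstSlice_add b (outerBoundary S),
        hb, hempty, hboundary]
      simp
    · push Not at hfull
      have h : ∀ b, (_root_.firstSlice b S).card ≤
          (_root_.firstSlice b (outerBoundary S)).card := fun b =>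
        (ih (hS.firstSlice b) (hfull b)).trans
          (Finset.card_le_card (outerBoundary_firstSlice_subset b S))
      rw [card_eq_card_firstSlice_add true S, card_eq_card_firstSlice_add true (outerBoundary S)]
      exact add_le_add (h _) (h _)

theorem hammingDist_flipCoord_le_one {n : ℕ} (x : Fin n → Bool) (i : Fin n) :
    hammingDist x (flipCoord x i) ≤ 1 := by
  refine (Finset.card_le_card (t := {i}) fun j hj => ?_).trans (Finset.card_singleton i).le
  by_contra hji
  exact (Finset.mem_filter.1 hj).2 (by simp [flipCoord, Finset.mem_singleton.not.1 hji])

theorem IsSubcube.faceClosed {n : ℕ} {S : Finset (Fin n → Bool)} (hS : IsSubcube S) :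
    FaceClosed S := by
  obtain ⟨P, c, rfl⟩ := hS
  intro x i j hij hx hi hj
  simp only [Finset.mem_filter, Finset.mem_univ, true_and] at *
  intro l hl
  by_cases hlj : l = j
  · subst hlj
    simpa [flipCoord, hij.symm] using hj l hl
  · simpa [flipCoord, hlj] using hi l hl

theorem faceClosed_biUnion {n : ℕ} {ι : Type*} [Fintype ι] {H : ι → Finset (Fin n → Bool)}
    (hH : ∀ i, FaceClosed (H i))
    (hdist : ∀ i j, i ≠ j → ∀ x ∈ H i, ∀ y ∈ H j, 2 ≤ hammingDist x y) :
    FaceClosed (Finset.univ.biUnion H) := by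
  have hsame : ∀ {a b x i}, x ∈ H a → flipCoord x i ∈ H b → flipCoord x i ∈ H a := by
    intro a b x i ha hb
    by_cases hab : a = b
    · rwa [hab]
    · have h₁ := hdist a b hab _ ha _ hb
      have h₂ := hammingDist_flipCoord_le_one x i
      omega
  intro x i j hij hx hi hj
  simp only [Finset.mem_biUnion, Finset.mem_univ, true_and] at *
  obtain ⟨a, ha⟩ := hx
  obtain ⟨b, hb⟩ := hi
  obtain ⟨d, hd⟩ := hj
  exact ⟨a, hH a x i j hij ha (hsame ha hb) (hsame ha hd)⟩

/-- **Lemma 4.** Let `H₁, …, H_k` be distinct subcubes of `Q_n` with pairwise Hamming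
distance at least 2, let `T` be their union and `T'` the set of vertices outside `T` with
a neighbour in `T`. If `T ≠ Q_n`, then `|T'| ≥ |T|`. -/
theorem card_boundary_ge_card_union_of_subcubes {n k : ℕ}
    (H : Fin k → Finset (Fin n → Bool))
    (hcube : ∀ i, IsSubcube (H i))
    (hdistinct : Function.Injective H)
    (hdist : ∀ i j, i ≠ j → ∀ x ∈ H i, ∀ y ∈ H j, 2 ≤ hammingDist x y)
    (T : Finset (Fin n → Bool)) (hT : T = Finset.univ.biUnion H)
    (T' : Finset (Fin n → Bool))
    (hT' : T' = Finset.univ.filter fun x => x ∉ T ∧ ∃ i, flipCoord x i ∈ T)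
    (hTne : T ≠ Finset.univ) :
    T.card ≤ T'.card := by
  subst hT hT'
  exact (faceClosed_biUnion (fun i => (hcube i).faceClosed) hdist).card_le_card_outerBoundary hTne
end

section
/- For every positive integer k there exists a Boolean function f with s_1(f) = 2, s_0(f) = k, and C_0(f) = ⌊(3/2)·k⌋ (equivalently, C_0(f) = ⌊(3/4)·s_0(f)·s_1(f)⌋). -/
/-- The sensitivity `s(f, x)` of a Boolean function `f` on input `x`:
the number of coordinates whose flip changes the value of `f`. -/
def sensAt {n : ℕ} (f : (Fin n → Bool) → Bool) (x : Fin n → Bool) : ℕ :=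
  (Finset.univ.filter fun i => f (flipCoord x i) ≠ f x).card

/-- The `b`-sensitivity `s_b(f)`: the maximum of `s(f, x)` over inputs `x` with `f x = b`. -/
def bSens {n : ℕ} (f : (Fin n → Bool) → Bool) (b : Bool) : ℕ :=
  (Finset.univ.filter fun x => f x = b).sup (sensAt f)

/-- The certificate complexity `C(f, x)`: the minimum size of a set `P` of coordinates
such that fixing the coordinates in `P` to their values in `x` forces the value of `f`. -/
noncomputable def certAt {n : ℕ} (f : (Fin n → Bool) → Bool) (x : Fin n → Bool) : ℕ :=
  sInf {k | ∃ P : Finset (Fin n), P.card = k ∧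
    ∀ y : Fin n → Bool, (∀ i ∈ P, y i = x i) → f y = f x}

/-- The `b`-certificate complexity `C_b(f)`: the maximum of `C(f, x)` over `x` with `f x = b`. -/
noncomputable def bCert {n : ℕ} (f : (Fin n → Bool) → Bool) (b : Bool) : ℕ :=
  (Finset.univ.filter fun x => f x = b).sup (certAt f)

/-- A Boolean function is non-constant if it takes two different values. -/
def NonConstant {n : ℕ} (f : (Fin n → Bool) → Bool) : Prop :=
  ∃ x y, f x ≠ f y

theorem sensAt_le_bSens {n : ℕ} (f : (Fin n → Bool) → Bool) {b : Bool} {x : Fin n → Bool}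
    (hx : f x = b) : sensAt f x ≤ bSens f b :=
  Finset.le_sup (f := sensAt f) (by simpa using hx)

theorem bSens_le {n : ℕ} {f : (Fin n → Bool) → Bool} {b : Bool} {c : ℕ}
    (h : ∀ x, f x = b → sensAt f x ≤ c) : bSens f b ≤ c :=
  Finset.sup_le fun x hx => h x (by simpa using hx)

theorem exists_sensAt_eq_bSens {n : ℕ} {f : (Fin n → Bool) → Bool} {b : Bool}
    (h : ∃ x, f x = b) : ∃ x, f x = b ∧ sensAt f x = bSens f b := by
  obtain ⟨x₀, hx₀⟩ := h
  obtain ⟨x, hx, e⟩ := Finset.exists_mem_eq_sup (Finset.univ.filter fun x => f x = b)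
    ⟨x₀, by simpa using hx₀⟩ (sensAt f)
  exact ⟨x, by simpa using hx, e.symm⟩

theorem certAt_le_bCert {n : ℕ} (f : (Fin n → Bool) → Bool) {b : Bool} {x : Fin n → Bool}
    (hx : f x = b) : certAt f x ≤ bCert f b :=
  Finset.le_sup (f := certAt f) (by simpa using hx)

theorem bCert_le {n : ℕ} {f : (Fin n → Bool) → Bool} {b : Bool} {c : ℕ}
    (h : ∀ x, f x = b → certAt f x ≤ c) : bCert f b ≤ c :=
  Finset.sup_le fun x hx => h x (by simpa using hx)

theorem exists_certAt_eq_bCert {n : ℕ} {f : (Fin n → Bool) → Bool} {b : Bool}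
    (h : ∃ x, f x = b) : ∃ x, f x = b ∧ certAt f x = bCert f b := by
  obtain ⟨x₀, hx₀⟩ := h
  obtain ⟨x, hx, e⟩ := Finset.exists_mem_eq_sup (Finset.univ.filter fun x => f x = b)
    ⟨x₀, by simpa using hx₀⟩ (certAt f)
  exact ⟨x, by simpa using hx, e.symm⟩

/-- The set `P` of coordinates certifies the value of `f` at `x`. -/
def Certifies {n : ℕ} (f : (Fin n → Bool) → Bool) (x : Fin n → Bool) (P : Finset (Fin n)) : Prop :=
  ∀ y : Fin n → Bool, (∀ i ∈ P, y i = x i) → f y = f x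

instance {n : ℕ} (f : (Fin n → Bool) → Bool) (x : Fin n → Bool) (P : Finset (Fin n)) :
    Decidable (Certifies f x P) :=
  inferInstanceAs (Decidable (∀ y : Fin n → Bool, (∀ i ∈ P, y i = x i) → f y = f x))

theorem Certifies.certAt_le {n : ℕ} {f : (Fin n → Bool) → Bool} {x : Fin n → Bool}
    {P : Finset (Fin n)} (h : Certifies f x P) : certAt f x ≤ P.card :=
  Nat.sInf_le ⟨P, rfl, h⟩

theorem exists_certifies_card_eq {n : ℕ} (f : (Fin n → Bool) → Bool) (x : Fin n → Bool) :
    ∃ P, Certifies f x P ∧ P.card = certAt f x := by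
  have hne : {k | ∃ P : Finset (Fin n), P.card = k ∧ Certifies f x P}.Nonempty :=
    ⟨_, Finset.univ, rfl, fun y hy => by rw [funext fun i => hy i (Finset.mem_univ i)]⟩
  obtain ⟨P, hc, hP⟩ := Nat.sInf_mem hne
  exact ⟨P, hP, hc⟩

theorem le_certAt {n c : ℕ} {f : (Fin n → Bool) → Bool} {x : Fin n → Bool}
    (h : ∀ P, Certifies f x P → c ≤ P.card) : c ≤ certAt f x := by
  obtain ⟨P, hP, hc⟩ := exists_certifies_card_eq f x
  exact hc ▸ h P hP

/-- The disjunction of two Boolean functions on disjoint sets of variables. -/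
def disjointOr {m n : ℕ} (f : (Fin m → Bool) → Bool) (g : (Fin n → Bool) → Bool) :
    (Fin (m + n) → Bool) → Bool :=
  fun z => f (fun i => z (Fin.castAdd n i)) || g (fun j => z (Fin.natAdd m j))

section DisjointOr

variable {m n : ℕ} {f : (Fin m → Bool) → Bool} {g : (Fin n → Bool) → Bool}
  {x : Fin m → Bool} {y : Fin n → Bool}

theorem disjointOr_append (f : (Fin m → Bool) → Bool) (g : (Fin n → Bool) → Bool)
    (x : Fin m → Bool) (y : Fin n → Bool) :
    disjointOr f g (Fin.append x y) = (f x || g y) := by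
  simp [disjointOr]

theorem forall_append {p : (Fin (m + n) → Bool) → Prop} :
    (∀ z, p z) ↔ ∀ x y, p (Fin.append x y) :=
  ⟨fun h _ _ => h _, fun h z => Fin.append_castAdd_natAdd (f := z) ▸ h _ _⟩

theorem flipCoord_append_castAdd (x : Fin m → Bool) (y : Fin n → Bool) (i : Fin m) :
    flipCoord (Fin.append x y) (Fin.castAdd n i) = Fin.append (flipCoord x i) y := by
  ext k
  refine Fin.addCases (fun a => ?_) (fun b => ?_) k
  · simp [flipCoord, Function.update_apply]
  · have h : Fin.natAdd m b ≠ Fin.castAdd n i := by simp [Fin.ext_iff]; omega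
    simp [flipCoord, h]

theorem flipCoord_append_natAdd (x : Fin m → Bool) (y : Fin n → Bool) (j : Fin n) :
    flipCoord (Fin.append x y) (Fin.natAdd m j) = Fin.append x (flipCoord y j) := by
  ext k
  refine Fin.addCases (fun a => ?_) (fun b => ?_) k
  · have h : Fin.castAdd n a ≠ Fin.natAdd m j := by simp [Fin.ext_iff]; omega
    simp [flipCoord, h]
  · simp [flipCoord, Function.update_apply]

theorem card_filter_fin_add (p : Fin (m + n) → Prop) [DecidablePred p] :
    (Finset.univ.filter p).card = (Finset.univ.filter fun i => p (Fin.castAdd n i)).card +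
      (Finset.univ.filter fun j => p (Fin.natAdd m j)).card := by
  simp only [Finset.card_filter, Fin.sum_univ_add]

theorem sensAt_disjointOr_of_false (hx : f x = false) (hy : g y = false) :
    sensAt (disjointOr f g) (Fin.append x y) = sensAt f x + sensAt g y := by
  simp [sensAt, card_filter_fin_add, flipCoord_append_castAdd,
    flipCoord_append_natAdd, disjointOr_append, hx, hy]

theorem sensAt_disjointOr_of_true_left (hx : f x = true) (hy : g y = false) :
    sensAt (disjointOr f g) (Fin.append x y) = sensAt f x := by
  simp [sensAt, card_filter_fin_add, flipCoord_append_castAdd,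
    flipCoord_append_natAdd, disjointOr_append, hx, hy]

theorem sensAt_disjointOr_of_true_right (hx : f x = false) (hy : g y = true) :
    sensAt (disjointOr f g) (Fin.append x y) = sensAt g y := by
  simp [sensAt, card_filter_fin_add, flipCoord_append_castAdd,
    flipCoord_append_natAdd, disjointOr_append, hx, hy]

theorem sensAt_disjointOr_of_true (hx : f x = true) (hy : g y = true) :
    sensAt (disjointOr f g) (Fin.append x y) = 0 := by
  simp [sensAt, card_filter_fin_add, flipCoord_append_castAdd,
    flipCoord_append_natAdd, disjointOr_append, hx, hy]

theorem bSens_disjointOr_false (hf : ∃ x, f x = false) (hg : ∃ y, g y = false) :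
    bSens (disjointOr f g) false = bSens f false + bSens g false := by
  apply le_antisymm
  · refine bSens_le (forall_append.2 fun x y h => ?_)
    rw [disjointOr_append, Bool.or_eq_false_iff] at h
    rw [sensAt_disjointOr_of_false h.1 h.2]
    exact add_le_add (sensAt_le_bSens f h.1) (sensAt_le_bSens g h.2)
  · obtain ⟨x, hx, ex⟩ := exists_sensAt_eq_bSens hf
    obtain ⟨y, hy, ey⟩ := exists_sensAt_eq_bSens hg
    rw [← ex, ← ey, ← sensAt_disjointOr_of_false hx hy]
    exact sensAt_le_bSens _ (by simp [disjointOr_append, hx, hy])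

theorem bSens_disjointOr_true (hf : ∃ x, f x = false) (hg : ∃ y, g y = false) :
    bSens (disjointOr f g) true = max (bSens f true) (bSens g true) := by
  apply le_antisymm
  · refine bSens_le (forall_append.2 fun x y h => ?_)
    rw [disjointOr_append] at h
    rcases hx : f x with _ | _ <;> rcases hy : g y with _ | _
    · simp [hx, hy] at h
    · rw [sensAt_disjointOr_of_true_right hx hy]
      exact le_max_of_le_right (sensAt_le_bSens g hy)
    · rw [sensAt_disjointOr_of_true_left hx hy]
      exact le_max_of_le_left (sensAt_le_bSens f hx)
    · simp [sensAt_disjointOr_of_true hx hy]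
  · obtain ⟨x₀, hx₀⟩ := hf
    obtain ⟨y₀, hy₀⟩ := hg
    refine max_le (bSens_le fun x hx => ?_) (bSens_le fun y hy => ?_)
    · rw [← sensAt_disjointOr_of_true_left hx hy₀]
      exact sensAt_le_bSens _ (by simp [disjointOr_append, hx])
    · rw [← sensAt_disjointOr_of_true_right hx₀ hy]
      exact sensAt_le_bSens _ (by simp [disjointOr_append, hy])

theorem certAt_disjointOr_of_false (hx : f x = false) (hy : g y = false) :
    certAt (disjointOr f g) (Fin.append x y) = certAt f x + certAt g y := by
  apply le_antisymm
  · obtain ⟨P, hP, eP⟩ := exists_certifies_card_eq f x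
    obtain ⟨Q, hQ, eQ⟩ := exists_certifies_card_eq g y
    have hPQ : Certifies (disjointOr f g) (Fin.append x y)
        ((P.disjSum Q).map finSumFinEquiv.toEmbedding) := by
      refine forall_append.2 fun x' y' h => ?_
      have hx' := hP x' fun i hi => by
        simpa using h (Fin.castAdd n i)
          (Finset.mem_map.2 ⟨.inl i, Finset.inl_mem_disjSum.2 hi, by simp⟩)
      have hy' := hQ y' fun j hj => by
        simpa using h (Fin.natAdd m j)
          (Finset.mem_map.2 ⟨.inr j, Finset.inr_mem_disjSum.2 hj, by simp⟩)
      rw [disjointOr_append, disjointOr_append, hx', hy']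
    simpa [eP, eQ] using hPQ.certAt_le
  · refine le_certAt fun R hR => ?_
    have hP : Certifies f x {i | Fin.castAdd n i ∈ R} := fun x' h => by
      have := hR (Fin.append x' y) fun i => by
        refine Fin.addCases (fun i hi => ?_) (fun j hj => ?_) i
        · simpa using h i (by simpa using hi)
        · simp
      simpa [disjointOr_append, hx, hy] using this
    have hQ : Certifies g y {j | Fin.natAdd m j ∈ R} := fun y' h => by
      have := hR (Fin.append x y') fun i => by
        refine Fin.addCases (fun i hi => ?_) (fun j hj => ?_) i
        · simp
        · simpa using h j (by simpa using hj)
      simpa [disjointOr_append, hx, hy] using this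
    have hcard : R.card = (Finset.univ.filter fun i => Fin.castAdd n i ∈ R).card +
        (Finset.univ.filter fun j => Fin.natAdd m j ∈ R).card := by
      simpa using card_filter_fin_add (· ∈ R)
    exact hcard ▸ add_le_add hP.certAt_le hQ.certAt_le

theorem bCert_disjointOr_false (hf : ∃ x, f x = false) (hg : ∃ y, g y = false) :
    bCert (disjointOr f g) false = bCert f false + bCert g false := by
  apply le_antisymm
  · refine bCert_le (forall_append.2 fun x y h => ?_)
    rw [disjointOr_append, Bool.or_eq_false_iff] at h
    rw [certAt_disjointOr_of_false h.1 h.2]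
    exact add_le_add (certAt_le_bCert f h.1) (certAt_le_bCert g h.2)
  · obtain ⟨x, hx, ex⟩ := exists_certAt_eq_bCert hf
    obtain ⟨y, hy, ey⟩ := exists_certAt_eq_bCert hg
    rw [← ex, ← ey, ← certAt_disjointOr_of_false hx hy]
    exact certAt_le_bCert _ (by simp [disjointOr_append, hx, hy])

end DisjointOr

theorem bCert_eq_of_certifies {n c : ℕ} {f : (Fin n → Bool) → Bool} {b : Bool}
    (hle : ∀ x, f x = b → ∃ P, P.card ≤ c ∧ Certifies f x P)
    (hge : ∃ x, f x = b ∧ ∀ P, Certifies f x P → c ≤ P.card) : bCert f b = c := by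
  apply le_antisymm
  · refine bCert_le fun x hx => ?_
    obtain ⟨P, hc, hP⟩ := hle x hx
    exact hP.certAt_le.trans hc
  · obtain ⟨x, hx, h⟩ := hge
    exact (le_certAt h).trans (certAt_le_bCert f hx)

/-- The conjunction of two bits. -/
def andTwo (x : Fin 2 → Bool) : Bool := x 0 && x 1

theorem bSens_andTwo_true : bSens andTwo true = 2 := by decide

theorem bSens_andTwo_false : bSens andTwo false = 1 := by decide

theorem bCert_andTwo_false : bCert andTwo false = 1 :=
  bCert_eq_of_certifies (by decide) (by decide)

/-- The function on four bits that tests whether the input is monotone (in either direction). -/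
def sortedFour (x : Fin 4 → Bool) : Bool :=
  decide (x 0 ≤ x 1 ∧ x 1 ≤ x 2 ∧ x 2 ≤ x 3) || decide (x 3 ≤ x 2 ∧ x 2 ≤ x 1 ∧ x 1 ≤ x 0)

theorem bSens_sortedFour_true : bSens sortedFour true = 2 := by decide +kernel

theorem bSens_sortedFour_false : bSens sortedFour false = 2 := by decide +kernel

theorem bCert_sortedFour_false : bCert sortedFour false = 3 :=
  bCert_eq_of_certifies (by decide +kernel)
    ⟨![false, true, false, true], by decide, by decide +kernel⟩

/-- **Theorem 6.** For every positive `k` there is a Boolean function `f` with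
`s₁(f) = 2`, `s₀(f) = k` and `C₀(f) = ⌊(3/2)·k⌋ = ⌊(3/4)·s₀(f)·s₁(f)⌋`. -/
theorem exists_sens1_two_cert0_three_halves (k : ℕ) (hk : 0 < k) :
    ∃ (n : ℕ) (f : (Fin n → Bool) → Bool),
      bSens f true = 2 ∧ bSens f false = k ∧ bCert f false = 3 * k / 2 := by
  induction k using Nat.twoStepInduction with
  | zero => exact absurd hk (lt_irrefl 0)
  | one => exact ⟨2, andTwo, bSens_andTwo_true, bSens_andTwo_false, bCert_andTwo_false⟩
  | more k ih _ =>
    rcases k.eq_zero_or_pos with rfl | hpos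
    · exact ⟨4, sortedFour, bSens_sortedFour_true, bSens_sortedFour_false, bCert_sortedFour_false⟩
    obtain ⟨n, f, h₁, h₀, hc⟩ := ih hpos
    have hf : ∃ x, f x = false := by
      by_contra! h
      have : bSens f false ≤ 0 := bSens_le fun x hx => absurd hx (h x)
      omega
    have hg : ∃ y, sortedFour y = false := ⟨![false, true, false, true], by decide⟩
    refine ⟨n + 4, disjointOr f sortedFour, ?_, ?_, ?_⟩
    · rw [bSens_disjointOr_true hf hg, h₁, bSens_sortedFour_true, max_self]
    · rw [bSens_disjointOr_false hf hg, h₀, bSens_sortedFour_false]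
    · rw [bCert_disjointOr_false hf hg, hc, bCert_sortedFour_false]
      omega
end
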